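/- Let k ≥ 1 and let x₀ < y₀ < x₁ < y₁ < ⋯ < x_k < y_k be real numbers. Let γ : ℝ → EuclideanSpace ℝ (Fin (2k)) be the moment curve, γ(t) j = t^(j+1). Then the sign of the determinant of the (2k) × (2k) matrix whose columns are, in this order, γ(x₁)−γ(x₀), γ(x₂)−γ(x₀), …, γ(x_k)−γ(x₀), γ(y₁)−γ(y₀), γ(y₂)−γ(y₀), …, γ(y_k)−γ(y₀) equals (−1)^(k(k−1)/2); that is, (−1)^(k(k−1)/2) times this determinant is strictly positive. (This is the sign computation in the moment-curve lemma of Appendix D: for two disjoint k-simplices whose vertices alternate along the moment curve, the intersection number of their images under the moment-curve map equals (−1)^(k(k−1)/2) times the corresponding entry of the vector o_γ.) -/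

import Mathlib

open Matrix Finset in
lemma mc_lastRow (n : ℕ) (z s : Fin (n + 1) → ℝ) (hz : Function.Injective z) :
    ((vandermonde z)ᵀ.updateRow (Fin.last n) s).det =
      (∑ i, s i / ∏ j ∈ univ.erase i, (z i - z j)) * (vandermonde z).det := by
  have hinj : Set.InjOn z (↑(univ : Finset (Fin (n + 1)))) := hz.injOn
  set P := Lagrange.interpolate univ z s with hP
  have hdeg : P.degree < #(univ : Finset (Fin (n + 1))) := Lagrange.degree_interpolate_lt s hinj
  have hev : ∀ i, P.eval (z i) = s i := fun i =>
    Lagrange.eval_interpolate_at_node s hinj (mem_univ i)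
  have hc := Lagrange.coeff_eq_sum hinj hdeg
  simp only [hev, card_univ, Fintype.card_fin, Nat.add_sub_cancel] at hc
  rw [← hc]
  have hnat : P.natDegree < n + 1 := by
    by_cases h0 : P = 0
    · simp [h0]
    · rw [Polynomial.natDegree_lt_iff_degree_lt h0]
      simpa using hdeg
  have hs : s = ∑ m : Fin (n + 1), P.coeff m • (vandermonde z)ᵀ m := by
    ext i
    rw [← hev i, Polynomial.eval_eq_sum_range' hnat, Finset.sum_range]
    simp [Finset.sum_apply, vandermonde_apply]
  have := det_updateRow_sum (vandermonde z)ᵀ (Fin.last n) (fun m => P.coeff m)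
  rw [← hs] at this
  rw [this]
  simp

open Finset in
lemma mc_prod_sign {ι : Type*} (t : Finset ι) (f : ι → ℝ) (inv : ι → Prop) [DecidablePred inv]
    (h1 : ∀ i ∈ t, inv i → f i < 0) (h2 : ∀ i ∈ t, ¬ inv i → 0 < f i) :
    0 < (-1 : ℝ) ^ (#(t.filter inv)) * ∏ i ∈ t, f i := by
  have : (-1 : ℝ) ^ (#(t.filter inv)) * ∏ i ∈ t, f i =
      ∏ i ∈ t, (if inv i then -1 else 1) * f i := by
    rw [Finset.prod_mul_distrib, Finset.prod_ite]
    simp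
  rw [this]
  refine Finset.prod_pos fun i hi => ?_
  split_ifs with h
  · have := h1 i hi h; linarith
  · have := h2 i hi h; linarith

/-- rank of the `i`-th point in the sorted list -/
def mcRank (k i : ℕ) : ℕ := if i ≤ k then 2 * i else if i ≤ 2 * k then 2 * (i - k) + 1 else 1

lemma mcRank_lt (k i : ℕ) (hi : i < 2 * k + 2) : mcRank k i < 2 * k + 2 := by
  unfold mcRank; split_ifs <;> omega

lemma mcRank_inj (k i j : ℕ) (hi : i < 2 * k + 2) (hj : j < 2 * k + 2)
    (h : mcRank k i = mcRank k j) : i = j := by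
  unfold mcRank at h; split_ifs at h <;> omega

lemma mc_card_Ioi (k : ℕ) (i : Fin (2 * k + 2)) :
    (((Finset.Ioi i).filter fun j : Fin (2 * k + 2) => mcRank k j < mcRank k i).card : ℕ) =
      if (i : ℕ) ≤ k then (i : ℕ) else if (i : ℕ) ≤ 2 * k then 1 else 0 := by
  rw [← Finset.card_map Fin.valEmbedding]
  have key : ∀ S : Finset ℕ, (∀ j, j ∈ S ↔ j < 2 * k + 2 ∧ (i : ℕ) < j ∧ mcRank k j < mcRank k i) →
      ((Finset.Ioi i).filter fun j : Fin (2 * k + 2) => mcRank k j < mcRank k i).map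
        Fin.valEmbedding = S := by
    intro S hS
    ext j
    rw [hS]
    simp only [Finset.mem_map, Finset.mem_filter, Finset.mem_Ioi, Fin.valEmbedding_apply]
    constructor
    · rintro ⟨a, ⟨h1, h2⟩, rfl⟩
      exact ⟨a.2, h1, h2⟩
    · rintro ⟨h0, h1, h2⟩
      exact ⟨⟨j, h0⟩, ⟨h1, h2⟩, rfl⟩
  have hi := i.2
  split_ifs with h1 h2
  · rcases Nat.eq_zero_or_pos (i : ℕ) with h0 | h0
    · rw [key ∅, h0]; · rfl
      intro j; simp [h0, mcRank]
    · rw [key (insert (2 * k + 1) (Finset.Ico (k + 1) (k + i)))]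
      · rw [Finset.card_insert_of_notMem (by simp; omega)]; simp; omega
      · intro j; simp only [Finset.mem_insert, Finset.mem_Ico, mcRank]
        split_ifs <;> omega
  · rw [key {2 * k + 1}]
    · simp
    · intro j; simp only [Finset.mem_singleton, mcRank]
      split_ifs <;> omega
  · rw [key ∅]
    · rfl
    · intro j; simp; omega

open Matrix Finset in
lemma mc_vandermonde_sign (k : ℕ) (p : ℕ → ℝ)
    (hp : ∀ a b, a < b → b < 2 * k + 2 → p a < p b) :
    0 < (-1 : ℝ) ^ (k * (k - 1) / 2) *
      (vandermonde fun i : Fin (2 * k + 2) => p (mcRank k i)).det := by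
  rw [det_vandermonde]
  have h : ∀ i : Fin (2 * k + 2), 0 < (-1 : ℝ) ^ (if (i : ℕ) ≤ k then (i : ℕ) else
      if (i : ℕ) ≤ 2 * k then 1 else 0) * ∏ j ∈ Ioi i, (p (mcRank k j) - p (mcRank k i)) := by
    intro i
    rw [← mc_card_Ioi]
    apply mc_prod_sign
    · intro j _ hj
      have := hp _ _ hj (mcRank_lt k i i.2); linarith
    · intro j hj hj'
      have hne : mcRank k i ≠ mcRank k j := fun h => by
        have := mcRank_inj k i j i.2 j.2 h
        have h3 := mem_Ioi.1 hj
        have h4 : (i : ℕ) < j := h3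
        omega
      have := hp (mcRank k i) (mcRank k j) (by omega) (mcRank_lt k j j.2); linarith
  have h2 := Finset.prod_pos (s := univ) fun i _ => h i
  rw [prod_mul_distrib, prod_pow_eq_pow_sum,
    Fin.sum_univ_eq_sum_range (fun i => if i ≤ k then i else if i ≤ 2 * k then 1 else 0)] at h2
  have hs : ∑ i ∈ range (2 * k + 2), (if i ≤ k then i else if i ≤ 2 * k then 1 else 0) =
      k * (k - 1) / 2 + 2 * k := by
    rw [show 2 * k + 2 = (k + 1) + (k + 1) by ring, sum_range_add]
    have e1 : ∑ i ∈ range (k + 1), (if i ≤ k then i else if i ≤ 2 * k then 1 else 0) =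
        k * (k - 1) / 2 + k := by
      rw [← Finset.sum_range_id, ← Finset.sum_range_succ]
      refine sum_congr rfl fun i hi => ?_
      have := mem_range.1 hi
      rw [if_pos (by omega)]
    have e2 : ∑ i ∈ range (k + 1), (if k + 1 + i ≤ k then k + 1 + i else
        if k + 1 + i ≤ 2 * k then 1 else 0) = k := by
      rw [Finset.sum_range_succ, if_neg (by omega), if_neg (by omega)]
      have : ∀ i ∈ range k, (if k + 1 + i ≤ k then k + 1 + i else
        if k + 1 + i ≤ 2 * k then 1 else 0) = 1 := by
        intro i hi
        have := mem_range.1 hi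
        rw [if_neg (by omega), if_pos (by omega)]
      rw [sum_congr rfl this]; simp
    rw [e1, e2]; ring
  rw [hs, pow_add, pow_mul] at h2
  simpa using h2

open Finset in
lemma mc_weight_pos (k : ℕ) (p : ℕ → ℝ)
    (hp : ∀ a b, a < b → b < 2 * k + 2 → p a < p b) (c : Fin (2 * k + 2)) (hc : k < (c : ℕ)) :
    0 < ∏ j ∈ univ.erase c, (p (mcRank k c) - p (mcRank k j)) := by
  let r : Fin (2 * k + 2) → Fin (2 * k + 2) := fun i => ⟨mcRank k i, mcRank_lt k i i.2⟩
  have hr : Function.Injective r := fun i j h =>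
    Fin.ext (mcRank_inj k i j i.2 j.2 (congrArg Fin.val h))
  have hb : Function.Bijective r := Finite.injective_iff_bijective.1 hr
  have hcard : #((univ.erase c).filter fun j : Fin (2 * k + 2) => mcRank k c < mcRank k j) =
      #(Ioi (r c)) := by
    refine card_bij (fun i _ => r i) ?_ (fun _ _ _ _ h => hr h) ?_
    · intro a ha
      exact mem_Ioi.2 (mem_filter.1 ha).2
    · intro b hb'
      obtain ⟨a, rfl⟩ := hb.2 b
      refine ⟨a, mem_filter.2 ⟨mem_erase.2 ⟨?_, mem_univ _⟩, show r c < r a from mem_Ioi.1 hb'⟩, rfl⟩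
      rintro rfl
      simp at hb'
  have hev : Even #(Ioi (r c)) := by
    rw [Fin.card_Ioi]
    have : ∃ m, mcRank k c = 2 * m + 1 ∧ m ≤ k := by
      unfold mcRank
      split_ifs
      · omega
      · exact ⟨c - k, rfl, by omega⟩
      · exact ⟨0, rfl, by omega⟩
    obtain ⟨m, hm, hmk⟩ := this
    refine ⟨k - m, ?_⟩
    simp only [r, hm]
    omega
  have := mc_prod_sign (univ.erase c) (fun j => p (mcRank k c) - p (mcRank k j))
    (fun j : Fin (2 * k + 2) => mcRank k c < mcRank k j)
    (fun j _ hj => by have := hp _ _ hj (mcRank_lt k j j.2); linarith)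
    (fun j hj hj' => by
      have hne : mcRank k c ≠ mcRank k j := fun h =>
        (mem_erase.1 hj).1 (Fin.ext (mcRank_inj k c j c.2 j.2 h)).symm
      have := hp (mcRank k j) (mcRank k c) (by omega) (mcRank_lt k c c.2); linarith)
  rw [hcard, hev.neg_one_pow, one_mul] at this
  exact this

/-- the reindexing -/
def mcFun (k : ℕ) : Fin 2 ⊕ Fin (2 * k) → Fin (2 * k + 2)
  | Sum.inl a => if a = 0 then 0 else Fin.last _
  | Sum.inr i => ⟨i + 1, by omega⟩

lemma mcFun_bij (k : ℕ) : Function.Bijective (mcFun k) := by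
  rw [Fintype.bijective_iff_injective_and_card]
  constructor
  · rintro (a | a) (b | b) h
    · fin_cases a <;> fin_cases b <;> simp [mcFun, Fin.ext_iff] at h ⊢
    · have := b.2
      fin_cases a <;> simp [mcFun, Fin.ext_iff] at h ⊢; omega
    · have := a.2
      fin_cases b <;> simp [mcFun, Fin.ext_iff] at h ⊢; omega
    · simpa [mcFun, Fin.ext_iff] using h
  · simp; omega

/-- the two point families, extended by zero and interleaved -/
noncomputable def mcPts (k : ℕ) (x y : Fin (k + 1) → ℝ) (n : ℕ) : ℝ :=
  if h : n / 2 < k + 1 then (if n % 2 = 0 then x ⟨n / 2, h⟩ else y ⟨n / 2, h⟩) else 0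

lemma mcPts_even (k : ℕ) (x y : Fin (k + 1) → ℝ) (n : ℕ) (h : n < k + 1) :
    mcPts k x y (2 * n) = x ⟨n, h⟩ := by
  have h1 : 2 * n / 2 = n := by omega
  have h2 : 2 * n % 2 = 0 := by omega
  simp [mcPts, h]

lemma mcPts_odd (k : ℕ) (x y : Fin (k + 1) → ℝ) (n : ℕ) (h : n < k + 1) :
    mcPts k x y (2 * n + 1) = y ⟨n, h⟩ := by
  have h1 : (2 * n + 1) / 2 = n := by omega
  have h2 : (2 * n + 1) % 2 = 1 := by omega
  simp [mcPts, h1, h2, h]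

lemma mcPts_mono (k : ℕ) (x y : Fin (k + 1) → ℝ) (hxy : ∀ i, x i < y i)
    (hyx : ∀ i : Fin k, y i.castSucc < x i.succ) (a b : ℕ) (hab : a < b) (hb : b < 2 * k + 2) :
    mcPts k x y a < mcPts k x y b := by
  have step : ∀ n, n + 1 < 2 * k + 2 → mcPts k x y n < mcPts k x y (n + 1) := by
    intro n hn
    rcases Nat.even_or_odd' n with ⟨m, rfl | rfl⟩
    · rw [mcPts_even k x y m (by omega), mcPts_odd k x y m (by omega)]
      exact hxy _
    · rw [mcPts_odd k x y m (by omega), show 2 * m + 1 + 1 = 2 * (m + 1) by ring,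
        mcPts_even k x y (m + 1) (by omega)]
      exact hyx ⟨m, by omega⟩
  induction b, hab using Nat.le_induction with
  | base => exact step _ hb
  | succ n hn ih => exact (ih (by omega)).trans (step n hb)

open Matrix in
lemma mc_block {m n : Type*} [Fintype m] [Fintype n] [DecidableEq m] [DecidableEq n]
    (A : Matrix m m ℝ) (P : Matrix m n ℝ) (C : Matrix n m ℝ) (D : Matrix n n ℝ) :
    (fromBlocks A (A * P) C D).det = A.det * (D - C * P).det := by
  have : fromBlocks A (A * P) C D = fromBlocks A 0 C (D - C * P) * fromBlocks 1 P 0 1 := by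
    rw [fromBlocks_multiply]; simp
  rw [this, det_mul, det_fromBlocks_zero₁₂, det_fromBlocks_zero₂₁]; simp


/-- The moment curve in `ℝ^m`: `γ(t) = (t, t², …, t^m)`. -/
def momentCurve (m : ℕ) (t : ℝ) : EuclideanSpace ℝ (Fin m) :=
  WithLp.toLp 2 fun j => t ^ ((j : ℕ) + 1)

/-- Sign computation in the moment-curve lemma of Appendix D: for reals
`x₀ < y₀ < x₁ < y₁ < ⋯ < x_k < y_k`, the determinant of the `2k × 2k` matrix whose first `k`
columns are `γ(x₁)−γ(x₀), …, γ(x_k)−γ(x₀)` and whose last `k` columns are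
`γ(y₁)−γ(y₀), …, γ(y_k)−γ(y₀)` (with `γ` the moment curve in `ℝ^{2k}`) has sign
`(−1)^(k(k−1)/2)`. -/
theorem momentCurve_block_det_sign (k : ℕ) (hk : 1 ≤ k)
    (x y : Fin (k + 1) → ℝ)
    (hxy : ∀ i, x i < y i)
    (hyx : ∀ i : Fin k, y i.castSucc < x i.succ) :
    0 < (-1 : ℝ) ^ (k * (k - 1) / 2) *
      Matrix.det (Matrix.of fun (i j : Fin (2 * k)) =>
        if h : j.val < k then
          momentCurve (2 * k) (x ⟨j.val + 1, by omega⟩) i - momentCurve (2 * k) (x 0) i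
        else
          momentCurve (2 * k) (y ⟨j.val - k + 1, by have := j.isLt; omega⟩) i -
            momentCurve (2 * k) (y 0) i) := by
  classical
  set p := mcPts k x y with hpdef
  have hp := mcPts_mono k x y hxy hyx
  set z : Fin (2 * k + 2) → ℝ := fun i => p (mcRank k i) with hz
  set s : Fin (2 * k + 2) → ℝ := fun i => if (i : ℕ) ≤ k then 0 else 1 with hs
  have hinj : Function.Injective z := by
    intro i j hij
    by_contra hne
    have hne' : mcRank k i ≠ mcRank k j := fun h => hne (Fin.ext (mcRank_inj k i j i.2 j.2 h))
    rcases lt_or_gt_of_ne hne' with h | h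
    · exact (hp _ _ h (mcRank_lt k j j.2)).ne hij
    · exact (hp _ _ h (mcRank_lt k i i.2)).ne hij.symm
  have hrow := mc_lastRow (2 * k + 1) z s hinj
  have ha : 0 < ∑ i, s i / ∏ j ∈ Finset.univ.erase i, (z i - z j) := by
    refine Finset.sum_pos' (fun i _ => ?_) ⟨Fin.last _, Finset.mem_univ _, ?_⟩
    · by_cases h : (i : ℕ) ≤ k
      · simp [hs, h]
      · have := mc_weight_pos k p hp i (by omega)
        simp only [hs, h, if_false]
        exact div_nonneg zero_le_one this.le
    · have := mc_weight_pos k p hp (Fin.last (2 * k + 1)) (by simp; omega)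
      have h : ¬ ((Fin.last (2 * k + 1) : Fin _) : ℕ) ≤ k := by simp; omega
      simp only [hs, h, if_false]
      exact div_pos zero_lt_one this
  have hv := mc_vandermonde_sign k p hp
  have hpos : 0 < (-1 : ℝ) ^ (k * (k - 1) / 2) *
      ((Matrix.vandermonde z).transpose.updateRow (Fin.last (2 * k + 1)) s).det := by
    rw [hrow, mul_left_comm]
    exact mul_pos ha hv
  let e := Equiv.ofBijective _ (mcFun_bij k)
  let A : Matrix (Fin 2) (Fin 2) ℝ := !![1, 1; 0, 1]
  let P : Matrix (Fin 2) (Fin (2 * k)) ℝ := Matrix.of fun a j =>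
    if a = 0 then (if (j : ℕ) < k then 1 else 0) else (if (j : ℕ) < k then 0 else 1)
  let C : Matrix (Fin (2 * k)) (Fin 2) ℝ := Matrix.of fun i a =>
    if a = 0 then x 0 ^ ((i : ℕ) + 1) else y 0 ^ ((i : ℕ) + 1)
  let D : Matrix (Fin (2 * k)) (Fin (2 * k)) ℝ := Matrix.of fun i j =>
    z ⟨j + 1, by omega⟩ ^ ((i : ℕ) + 1)
  have hz0 : z 0 = x 0 := by
    have := mcPts_even k x y 0 (by omega)
    simpa [hz, mcRank] using this
  have hzl : z (Fin.last _) = y 0 := by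
    have := mcPts_odd k x y 0 (by omega)
    have h1 : ¬ (2 * k + 1 ≤ k) := by omega
    simpa [hz, mcRank, h1] using this
  have hblk : ((Matrix.vandermonde z).transpose.updateRow (Fin.last (2 * k + 1)) s).submatrix e e =
      Matrix.fromBlocks A (A * P) C D := by
    have e0 : e (Sum.inl 0) = 0 := rfl
    have e1 : e (Sum.inl 1) = Fin.last _ := rfl
    have e2 : ∀ i, e (Sum.inr i) = ⟨i + 1, by omega⟩ := fun i => rfl
    have s0 : s 0 = 0 := by simp [hs]
    have s1 : s (Fin.last _) = 1 := by
      have h1 : ¬ (2 * k + 1 ≤ k) := by omega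
      simp [hs, h1]
    have n0 : (0 : Fin (2 * k + 2)) ≠ Fin.last _ := by simp [Fin.ext_iff]
    have n2 : ∀ i : Fin (2 * k), (⟨i + 1, by omega⟩ : Fin (2 * k + 2)) ≠ Fin.last _ := by
      intro i h
      have h3 : (i : ℕ) + 1 = 2 * k + 1 := congrArg Fin.val h
      omega
    have AP0 : ∀ b, (A * P) 0 b = 1 := by
      intro b
      rw [Matrix.mul_apply, Fin.sum_univ_two]
      by_cases h : (b : ℕ) < k <;> simp [A, P, h]
    have AP1 : ∀ b : Fin (2 * k), (A * P) 1 b = if (b : ℕ) < k then 0 else 1 := by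
      intro b
      rw [Matrix.mul_apply, Fin.sum_univ_two]
      simp [A, P]
    ext a b
    rw [Matrix.submatrix_apply, Matrix.updateRow_apply]
    rcases a with a | a <;> rcases b with b | b
    · rw [Matrix.fromBlocks_apply₁₁]
      fin_cases a <;> fin_cases b <;>
        simp [e0, e1, n0, s0, s1, A, Matrix.vandermonde_apply]
    · rw [Matrix.fromBlocks_apply₁₂]
      fin_cases a
      · simp [e0, e2, n0, AP0, Matrix.vandermonde_apply]
      · simp [e1, e2, AP1, hs]
    · rw [Matrix.fromBlocks_apply₂₁, e2, if_neg (n2 a)]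
      fin_cases b <;> simp [e0, e1, C, Matrix.vandermonde_apply, hz0, hzl]
    · rw [Matrix.fromBlocks_apply₂₂, e2, e2, if_neg (n2 a)]
      simp [D, Matrix.vandermonde_apply]
  rw [← Matrix.det_submatrix_equiv_self e, hblk, mc_block] at hpos
  have hA : A.det = 1 := by simp [A, Matrix.det_fin_two]
  rw [hA, one_mul] at hpos
  convert hpos using 3
  ext i j
  have hj := j.2
  by_cases h : (j : ℕ) < k
  · have h3 : z ⟨j + 1, by omega⟩ = x ⟨j + 1, by omega⟩ := by
      have := mcPts_even k x y (j + 1) (by omega)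
      have h4 : (j : ℕ) + 1 ≤ k := by omega
      simpa [hz, mcRank, h4] using this
    simp [h, D, C, P, Matrix.mul_apply, Fin.sum_univ_two, momentCurve, h3]
  · have h3 : z ⟨j + 1, by omega⟩ = y ⟨j - k + 1, by omega⟩ := by
      have := mcPts_odd k x y (j - k + 1) (by omega)
      have h4 : ¬ (j : ℕ) + 1 ≤ k := by omega
      have h5 : (j : ℕ) + 1 ≤ 2 * k := by omega
      have h6 : (j : ℕ) + 1 - k = j - k + 1 := by omega
      simp only [hz, mcRank, h4, h5, h6, if_false, if_true]
      exact this
    simp [h, D, C, P, Matrix.mul_apply, Fin.sum_univ_two, momentCurve, h3]
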